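/- arXiv:2509.01045 — 11 statements merged into one kernel-verified Lean document; each statement's English description precedes it below -/
import Mathlib

section
/- Let R be a commutative ring, S a regular multiplicative subset of R, and M an R-module that admits the structure of a module over the localization R_S (i.e., M is an R_S-module, viewed as an R-module via restriction of scalars). Then M is S-injective: for every ideal I of R with I ∩ S ≠ ∅, every R-module homomorphism I → M extends to an R-module homomorphism R → M (equivalently, Ext^1_R(R/I, M) = 0 for every such ideal I). -/
/-- `Ext¹_R(A, B) = 0`, phrased via the standard characterization:
every short exact sequence `0 → B → X → A → 0` of `R`-modules splits. -/
def Ext1Vanishes (R : Type) [CommRing R] (A : Type) [AddCommGroup A] [Module R A]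
    (B : Type) [AddCommGroup B] [Module R B] : Prop :=
  ∀ (X : Type) [AddCommGroup X] [Module R X] (i : B →ₗ[R] X) (p : X →ₗ[R] A),
    Function.Injective i → Function.Surjective p → LinearMap.range i = LinearMap.ker p →
      ∃ s : A →ₗ[R] X, p ∘ₗ s = LinearMap.id

/-- An `R`-module `N` is `S`-weakly cotorsion if `Ext¹_R(R_S, N) = 0`. -/
def SWeaklyCotorsion (R : Type) [CommRing R] (S : Submonoid R)
    (N : Type) [AddCommGroup N] [Module R N] : Prop :=
  Ext1Vanishes R (Localization S) N

/-- An `R`-module `F` is `S`-strongly flat if `Ext¹_R(F, N) = 0` for every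
`S`-weakly cotorsion `R`-module `N`. -/
def SStronglyFlat (R : Type) [CommRing R] (S : Submonoid R)
    (F : Type) [AddCommGroup F] [Module R F] : Prop :=
  ∀ (N : Type) [AddCommGroup N] [Module R N], SWeaklyCotorsion R S N → Ext1Vanishes R F N

/-- An `R`-module `M` is `S`-divisible if `sM = M` for every `s ∈ S`. -/
def SDivisible (R : Type) [CommRing R] (S : Submonoid R)
    (M : Type) [AddCommGroup M] [Module R M] : Prop :=
  ∀ s ∈ S, ∀ m : M, ∃ n : M, s • n = m

/-- An `R`-module `M` is `S`-`h`-divisible if `M` is the sum of the images of all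
`R`-linear maps `R_S → M`. -/
def SHDivisible (R : Type) [CommRing R] (S : Submonoid R)
    (M : Type) [AddCommGroup M] [Module R M] : Prop :=
  (⨆ f : Localization S →ₗ[R] M, LinearMap.range f) = ⊤

/-- An `R`-module `M` is `S`-injective if for every ideal `I` of `R` meeting `S`, every
`R`-linear map `I → M` extends to `R` (equivalently, `Ext¹_R(R/I, M) = 0` for such `I`). -/
def SInjective (R : Type) [CommRing R] (S : Submonoid R)
    (M : Type) [AddCommGroup M] [Module R M] : Prop :=
  ∀ I : Ideal R, ((I : Set R) ∩ (S : Set R)).Nonempty →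
    ∀ f : I →ₗ[R] M, ∃ g : R →ₗ[R] M, ∀ x : I, g (x : R) = f x

/-- An `R`-module `T` is `S`-torsion if each of its elements is annihilated by some `s ∈ S`. -/
def STorsion (R : Type) [CommRing R] (S : Submonoid R)
    (T : Type) [AddCommGroup T] [Module R T] : Prop :=
  ∀ t : T, ∃ s ∈ S, s • t = 0

/-- If `S` is a regular multiplicative subset of a commutative ring `R` and `M` is an
`R`-module that carries a compatible `R_S`-module structure, then `M` is `S`-injective. -/
theorem rs_module_is_S_injective (R : Type) [CommRing R] (S : Submonoid R)
    (hreg : S ≤ nonZeroDivisors R)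
    (M : Type) [AddCommGroup M] [Module R M] [Module (Localization S) M]
    [IsScalarTower R (Localization S) M] :
    SInjective R S M := by
  rintro I ⟨s, hsI, hsS⟩ f
  have smul_s (m : M) : Localization.mk 1 ⟨s, hsS⟩ • s • m = m := by
    rw [← algebraMap_smul (Localization S) s m, smul_smul, ← Localization.mk_one_eq_algebraMap,
      Localization.mk_mul, one_mul, mul_one, Localization.mk_self ⟨s, hsS⟩, one_smul]
  refine ⟨LinearMap.toSpanSingleton R M (Localization.mk 1 ⟨s, hsS⟩ • f ⟨s, hsI⟩), fun x ↦ ?_⟩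
  have hcomm : (x : R) • (⟨s, hsI⟩ : I) = s • x := Subtype.ext (mul_comm (x : R) s)
  rw [LinearMap.toSpanSingleton_apply, smul_comm, ← map_smul, hcomm, map_smul, smul_s]
end

section
/- Let R be a commutative ring and S a regular multiplicative subset of R. An R-module M is S-h-divisible if and only if M is a quotient (homomorphic image) of an S-injective R-module. -/
/-- A module over the localization `R_S` is `S`-injective over `R`. -/
theorem SInjective.of_isScalarTower_localization (R : Type) [CommRing R] (S : Submonoid R)
    (E : Type) [AddCommGroup E] [Module R E] [Module (Localization S) E]
    [IsScalarTower R (Localization S) E] : SInjective R S E := by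
  rintro I ⟨s, hsI, hsS⟩ f
  have hinv : ∀ e : E, s • Localization.mk (1 : R) ⟨s, hsS⟩ • e = e := fun e ↦ by
    rw [← smul_assoc, Localization.smul_mk, smul_eq_mul, mul_one,
      Localization.mk_self (⟨s, hsS⟩ : S), one_smul]
  refine ⟨LinearMap.toSpanSingleton R E
    (Localization.mk (1 : R) ⟨s, hsS⟩ • f ⟨s, hsI⟩), fun x ↦ ?_⟩
  have hcomm : (x : R) • f ⟨s, hsI⟩ = s • f x := by
    rw [← map_smul, ← map_smul]
    congr 1
    ext
    exact mul_comm _ _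
  rw [LinearMap.toSpanSingleton_apply, ← algebraMap_smul (Localization S) (x : R),
    smul_comm, algebraMap_smul, hcomm, ← algebraMap_smul (Localization S) s, smul_comm,
    algebraMap_smul, hinv]

/-- Maps into an `S`-injective module extend along injections whose cokernel is `S`-torsion. -/
theorem SInjective.exists_extension {R : Type} [CommRing R] {S : Submonoid R}
    {E : Type} [AddCommGroup E] [Module R E] (hE : SInjective R S E)
    {A B : Type*} [AddCommGroup A] [Module R A] [AddCommGroup B] [Module R B]
    (i : A →ₗ[R] B) (hi : Function.Injective i)
    (htors : ∀ b : B, ∃ s ∈ S, s • b ∈ LinearMap.range i) (f : A →ₗ[R] E) :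
    ∃ g : B →ₗ[R] E, ∀ a, g (i a) = f a := by
  have : Fact (Function.Injective i) := ⟨hi⟩
  let φ := Module.Baer.extensionOfMax i f
  have htop : ∀ y : B, y ∈ φ.domain := by
    intro y
    obtain ⟨s, hs, hsy⟩ := htors y
    obtain ⟨g, hg⟩ := hE (Module.Baer.ExtensionOfMaxAdjoin.ideal i f y) ⟨s, φ.le hsy, hs⟩
      (Module.Baer.ExtensionOfMaxAdjoin.idealTo i f y)
    have hg_apply : ∀ (r : R) (hr : r • y ∈ φ.domain), r • g 1 = φ.toLinearPMap ⟨r • y, hr⟩ := by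
      intro r hr
      rw [← map_smul, smul_eq_mul, mul_one]
      exact hg ⟨r, hr⟩
    have hzero : ∀ c : R, c • y = 0 → RingHom.id R c • g 1 = 0 := by
      intro c hc
      have hmem : c • y ∈ φ.domain := hc ▸ φ.domain.zero_mem
      rw [RingHom.id_apply, hg_apply c hmem]
      have : (⟨c • y, hmem⟩ : φ.domain) = 0 := Subtype.ext hc
      rw [this, LinearPMap.map_zero]
    let ψ : B →ₗ.[R] E := LinearPMap.mkSpanSingleton' y (g 1) hzero
    have hcompat : ∀ (x : φ.domain) (z : ψ.domain), (x : B) = z → φ.toLinearPMap x = ψ z := by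
      rintro ⟨x, hx⟩ ⟨z, hz⟩ (rfl : x = z)
      obtain ⟨c, rfl⟩ := Submodule.mem_span_singleton.1 hz
      rw [← hg_apply c hx]
      exact (LinearPMap.mkSpanSingleton'_apply y (g 1) hzero c hz).symm
    have hle := LinearPMap.left_le_sup φ.toLinearPMap ψ hcompat
    let χ : Module.Baer.ExtensionOf i f :=
      { φ.toLinearPMap.sup ψ hcompat with
        le := φ.le.trans hle.1
        is_extension := fun a ↦ (φ.is_extension a).trans (hle.2 rfl) }
    have hχ : χ = φ := Module.Baer.extensionOfMax_is_max i f χ hle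
    rw [← hχ]
    exact (LinearPMap.right_le_sup φ.toLinearPMap ψ hcompat).1 (Submodule.mem_span_singleton_self y)
  exact ⟨φ.toLinearPMap.toFun ∘ₗ LinearMap.id.codRestrict φ.domain htop,
    fun a ↦ (φ.is_extension a).symm⟩

/-- If `S` is regular, every element of an `S`-injective module is the image of `1` under a
linear map from `R_S`. -/
theorem SInjective.exists_localization_map_one {R : Type} [CommRing R] {S : Submonoid R}
    (hreg : S ≤ nonZeroDivisors R) {E : Type} [AddCommGroup E] [Module R E]
    (hE : SInjective R S E) (e : E) : ∃ f : Localization S →ₗ[R] E, f 1 = e := by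
  obtain ⟨f, hf⟩ := hE.exists_extension (Algebra.linearMap R (Localization S))
    (IsLocalization.injective (Localization S) hreg)
    (fun b ↦ by
      obtain ⟨⟨r, s⟩, hrs⟩ := IsLocalization.surj S b
      exact ⟨s, s.2, r, by rw [Algebra.smul_def, mul_comm]; exact hrs.symm⟩)
    (LinearMap.toSpanSingleton R E e)
  exact ⟨f, by simpa using hf 1⟩

/-- Over a commutative ring `R` with a regular multiplicative subset `S`, an `R`-module is
`S`-`h`-divisible iff it is a quotient of an `S`-injective `R`-module. -/
theorem sHDivisible_iff_quotient_of_sInjective (R : Type) [CommRing R] (S : Submonoid R)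
    (hreg : S ≤ nonZeroDivisors R)
    (M : Type) [AddCommGroup M] [Module R M] :
    SHDivisible R S M ↔
      ∃ (E : Type) (_ : AddCommGroup E) (_ : Module R E),
        SInjective R S E ∧ ∃ g : E →ₗ[R] M, Function.Surjective g := by
  constructor
  · intro hM
    refine ⟨(Localization S →ₗ[R] M) →₀ Localization S, inferInstance, inferInstance,
      SInjective.of_isScalarTower_localization R S _, Finsupp.lsum R (fun f ↦ f), ?_⟩
    rw [← LinearMap.range_eq_top, eq_top_iff, ← show _ = _ from hM]
    refine iSup_le fun f ↦ ?_
    rintro _ ⟨x, rfl⟩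
    exact ⟨Finsupp.single f x, by simp⟩
  · rintro ⟨E, _, _, hE, g, hg⟩
    refine Submodule.eq_top_iff'.2 fun m ↦ ?_
    obtain ⟨e, rfl⟩ := hg m
    obtain ⟨f, rfl⟩ := hE.exists_localization_map_one hreg e
    exact Submodule.mem_iSup_of_mem (g ∘ₗ f) ⟨1, rfl⟩
end

section
/- Let R be a commutative ring, S a multiplicative subset of R, and M an R-module. Let d(M) be the sum of all S-divisible submodules of M. Then the inclusion map i : d(M) ↪ M is an S-divisible cover of M; that is: d(M) is S-divisible; every R-module homomorphism g : D → M with D an S-divisible R-module factors through i; and every endomorphism h of d(M) with i ∘ h = i is an automorphism of d(M). In particular, every R-module admits an S-divisible cover. -/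
/-- `divPart R S M` is the sum `d(M)` of all `S`-divisible submodules of `M`. -/
def divPart (R : Type) [CommRing R] (S : Submonoid R)
    (M : Type) [AddCommGroup M] [Module R M] : Submodule R M :=
  sSup {N : Submodule R M | SDivisible R S ↥N}

theorem sDivisible_iff_le_map_lsmul {R : Type} [CommRing R] {S : Submonoid R}
    {M : Type} [AddCommGroup M] [Module R M] {N : Submodule R M} :
    SDivisible R S ↥N ↔ ∀ s ∈ S, N ≤ N.map (LinearMap.lsmul R M s) := by
  constructor
  · intro h s hs m hm
    obtain ⟨n, hn⟩ := h s hs ⟨m, hm⟩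
    exact ⟨n, n.2, congrArg Subtype.val hn⟩
  · rintro h s hs ⟨m, hm⟩
    obtain ⟨n, hn, hnm⟩ := h s hs hm
    exact ⟨⟨n, hn⟩, Subtype.ext hnm⟩

theorem sDivisible_divPart (R : Type) [CommRing R] (S : Submonoid R)
    (M : Type) [AddCommGroup M] [Module R M] : SDivisible R S ↥(divPart R S M) :=
  sDivisible_iff_le_map_lsmul.2 fun s hs => sSup_le fun _ hN =>
    (sDivisible_iff_le_map_lsmul.1 hN s hs).trans (Submodule.map_mono (le_sSup hN))

theorem SDivisible.range {R : Type} [CommRing R] {S : Submonoid R}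
    {D : Type} [AddCommGroup D] [Module R D] {M : Type} [AddCommGroup M] [Module R M]
    (hD : SDivisible R S D) (g : D →ₗ[R] M) : SDivisible R S ↥(LinearMap.range g) := by
  rintro s hs ⟨_, d, rfl⟩
  obtain ⟨e, rfl⟩ := hD s hs d
  exact ⟨⟨g e, e, rfl⟩, Subtype.ext (g.map_smul s e).symm⟩

/-- The inclusion `d(M) ↪ M` of the sum of all `S`-divisible submodules is an
`S`-divisible cover of `M`: `d(M)` is `S`-divisible, every map from an `S`-divisible module
to `M` factors through the inclusion, and any endomorphism of `d(M)` commuting with the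
inclusion is an automorphism. -/
theorem sDivisible_cover (R : Type) [CommRing R] (S : Submonoid R)
    (M : Type) [AddCommGroup M] [Module R M] :
    SDivisible R S ↥(divPart R S M) ∧
    (∀ (D : Type) [AddCommGroup D] [Module R D], SDivisible R S D →
      ∀ g : D →ₗ[R] M, ∃ g' : D →ₗ[R] ↥(divPart R S M),
        (divPart R S M).subtype ∘ₗ g' = g) ∧
    (∀ h : ↥(divPart R S M) →ₗ[R] ↥(divPart R S M),
      (divPart R S M).subtype ∘ₗ h = (divPart R S M).subtype → Function.Bijective h) := by
  refine ⟨sDivisible_divPart R S M, fun D _ _ hD g => ?_, fun h hh => ?_⟩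
  · have hg : LinearMap.range g ≤ divPart R S M := le_sSup (hD.range g)
    exact ⟨g.codRestrict _ fun d => hg ⟨d, rfl⟩, LinearMap.subtype_comp_codRestrict _ _ _⟩
  · have hid : h = LinearMap.id :=
      LinearMap.ext fun x => Subtype.ext (LinearMap.congr_fun hh x)
    rw [hid]
    exact Function.bijective_id
end

section
/- Let R be a commutative ring, S a multiplicative subset of R, and M an R-module. Let h(M) be the sum of all S-h-divisible submodules of M. Then the inclusion map i : h(M) ↪ M is an S-h-divisible cover of M; that is: h(M) is S-h-divisible; every R-module homomorphism g : D → M with D an S-h-divisible R-module factors through i; and every endomorphism h of h(M) with i ∘ h = i is an automorphism. In particular, every R-module admits an S-h-divisible cover. -/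
/-- `hDivPart R S M` is the sum `h(M)` of all `S`-`h`-divisible submodules of `M`. -/
def hDivPart (R : Type) [CommRing R] (S : Submonoid R)
    (M : Type) [AddCommGroup M] [Module R M] : Submodule R M :=
  sSup {N : Submodule R M | SHDivisible R S ↥N}

/-- The range of a map out of an `S`-`h`-divisible module is contained in the sum of the
images of all maps from the localization. -/
theorem SHDivisible.range_le {R : Type} [CommRing R] {S : Submonoid R}
    {D : Type} [AddCommGroup D] [Module R D] {M : Type} [AddCommGroup M] [Module R M]
    (hD : SHDivisible R S D) (g : D →ₗ[R] M) :
    LinearMap.range g ≤ ⨆ f : Localization S →ₗ[R] M, LinearMap.range f := by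
  rw [LinearMap.range_eq_map, ← show _ = ⊤ from hD, Submodule.map_iSup]
  refine iSup_le fun f => ?_
  rw [← LinearMap.range_comp]
  exact le_iSup (fun f : Localization S →ₗ[R] M => LinearMap.range f) (g ∘ₗ f)

/-- A quotient of an `S`-`h`-divisible module is `S`-`h`-divisible. -/
theorem SHDivisible.of_surjective {R : Type} [CommRing R] {S : Submonoid R}
    {D : Type} [AddCommGroup D] [Module R D] {M : Type} [AddCommGroup M] [Module R M]
    (hD : SHDivisible R S D) (g : D →ₗ[R] M) (hg : Function.Surjective g) :
    SHDivisible R S M :=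
  top_le_iff.mp ((LinearMap.range_eq_top.mpr hg).ge.trans (hD.range_le g))

/-- The sum of all `S`-`h`-divisible submodules is `S`-`h`-divisible. -/
theorem sHDivisible_hDivPart (R : Type) [CommRing R] (S : Submonoid R)
    (M : Type) [AddCommGroup M] [Module R M] : SHDivisible R S ↥(hDivPart R S M) := by
  set P := hDivPart R S M
  have key : P ≤ (⨆ f : Localization S →ₗ[R] P, LinearMap.range f).map P.subtype := by
    refine sSup_le fun N hN => ?_
    have hNP : N ≤ P := le_sSup hN
    intro x hx
    exact ⟨⟨x, hNP hx⟩,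
      SHDivisible.range_le hN (Submodule.inclusion hNP) ⟨⟨x, hx⟩, rfl⟩, rfl⟩
  refine eq_top_iff.mpr fun x _ => ?_
  obtain ⟨y, hy, hyx⟩ := key x.2
  rwa [← Subtype.ext hyx]

/-- The inclusion `h(M) ↪ M` of the sum of all `S`-`h`-divisible submodules is an
`S`-`h`-divisible cover of `M`: `h(M)` is `S`-`h`-divisible, every map from an
`S`-`h`-divisible module to `M` factors through the inclusion, and any endomorphism of
`h(M)` commuting with the inclusion is an automorphism. -/
theorem sHDivisible_cover (R : Type) [CommRing R] (S : Submonoid R)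
    (M : Type) [AddCommGroup M] [Module R M] :
    SHDivisible R S ↥(hDivPart R S M) ∧
    (∀ (D : Type) [AddCommGroup D] [Module R D], SHDivisible R S D →
      ∀ g : D →ₗ[R] M, ∃ g' : D →ₗ[R] ↥(hDivPart R S M),
        (hDivPart R S M).subtype ∘ₗ g' = g) ∧
    (∀ h : ↥(hDivPart R S M) →ₗ[R] ↥(hDivPart R S M),
      (hDivPart R S M).subtype ∘ₗ h = (hDivPart R S M).subtype → Function.Bijective h) := by
  refine ⟨sHDivisible_hDivPart R S M, fun D _ _ hD g => ?_, fun h hh => ?_⟩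
  · have hg : LinearMap.range g ≤ hDivPart R S M :=
      le_sSup (hD.of_surjective g.rangeRestrict g.surjective_rangeRestrict)
    exact ⟨g.codRestrict _ fun x => hg ⟨x, rfl⟩, LinearMap.subtype_comp_codRestrict _ _ _⟩
  · have hid : h = LinearMap.id :=
      LinearMap.ext fun x => Subtype.ext (LinearMap.congr_fun hh x)
    rw [hid]
    exact Function.bijective_id
end

section
/- Let M be a module over a ring, T a submodule of M, and suppose M/T is an internal direct sum of submodules U_i (i ranging over an index set). For each i, let T_i be the inverse image of U_i in M under the quotient map M → M/T. If T is a direct summand of T_i for every i, then T is a direct summand of M. -/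
namespace Submodule

variable {R M : Type*} [CommRing R] [AddCommGroup M] [Module R M] {T : Submodule R M}

/-- A complement of `T` in the preimage of `U` yields a lift of `U` along `M → M ⧸ T`. -/
theorem exists_section_of_sup_eq_comap_mkQ {U : Submodule R (M ⧸ T)} {C : Submodule R M}
    (hinf : T ⊓ C = ⊥) (hsup : T ⊔ C = U.comap T.mkQ) :
    ∃ s : U →ₗ[R] M, T.mkQ ∘ₗ s = U.subtype := by
  have hC : ∀ c ∈ C, T.mkQ c ∈ U := fun c hc ↦ by
    have : c ∈ U.comap T.mkQ := hsup ▸ mem_sup_right hc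
    exact this
  let f : C →ₗ[R] U := T.mkQ.restrict hC
  have hf : Function.Bijective f := by
    constructor
    · refine (injective_iff_map_eq_zero f).2 fun c hc ↦ Subtype.ext ?_
      have hcT : (c : M) ∈ T := (Quotient.mk_eq_zero T).1 (congrArg Subtype.val hc)
      exact (mem_bot R).1 (hinf ▸ mem_inf.2 ⟨hcT, c.2⟩)
    · rintro ⟨u, hu⟩
      obtain ⟨m, rfl⟩ := T.mkQ_surjective u
      have hm : m ∈ T ⊔ C := hsup ▸ hu
      obtain ⟨t, ht, c, hc, rfl⟩ := mem_sup.1 hm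
      refine ⟨⟨c, hc⟩, Subtype.ext ?_⟩
      change T.mkQ c = T.mkQ (t + c)
      rw [map_add, mkQ_apply T t, (Quotient.mk_eq_zero T).2 ht, zero_add]
  let e := LinearEquiv.ofBijective f hf
  exact ⟨C.subtype ∘ₗ e.symm.toLinearMap, LinearMap.ext fun u ↦
    congrArg Subtype.val (e.apply_symm_apply u)⟩

/-- The range of a section of the quotient map `M → M ⧸ T` is a complement of `T`. -/
theorem isCompl_range_of_mkQ_section {g : (M ⧸ T) →ₗ[R] M} (hg : ∀ x, T.mkQ (g x) = x) :
    IsCompl T (LinearMap.range g) := by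
  refine ⟨disjoint_def.2 ?_, codisjoint_iff.2 (eq_top_iff'.2 fun m ↦ ?_)⟩
  · rintro _ hx ⟨y, rfl⟩
    rw [← hg y, mkQ_apply, (Quotient.mk_eq_zero T).2 hx, map_zero]
  · refine mem_sup.2 ⟨m - g (T.mkQ m), ?_, g (T.mkQ m), ⟨_, rfl⟩, sub_add_cancel _ _⟩
    rw [← Quotient.mk_eq_zero T, ← mkQ_apply, map_sub, hg, sub_self]

end Submodule


/-- (Kaplansky) Let `T` be a submodule of `M` such that `M/T` is the internal direct sum of a
family of submodules `U i`, and let `T i` be the preimage in `M` of `U i`. If `T` is a direct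
summand of each `T i`, then `T` is a direct summand of `M`. -/
theorem summand_of_summand_of_preimages (R : Type) [CommRing R]
    (M : Type) [AddCommGroup M] [Module R M] (T : Submodule R M)
    (ι : Type) [DecidableEq ι] (U : ι → Submodule R (M ⧸ T))
    (hU : DirectSum.IsInternal U)
    (hT : ∀ i, ∃ C : Submodule R M, T ⊓ C = ⊥ ∧ T ⊔ C = (U i).comap T.mkQ) :
    ∃ C : Submodule R M, IsCompl T C := by
  have hs : ∀ i, ∃ s : U i →ₗ[R] M, T.mkQ ∘ₗ s = (U i).subtype := fun i ↦ by
    obtain ⟨C, hinf, hsup⟩ := hT i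
    exact Submodule.exists_section_of_sup_eq_comap_mkQ hinf hsup
  choose s hs using hs
  let e := LinearEquiv.ofBijective (DirectSum.coeLinearMap U) hU
  let g : (M ⧸ T) →ₗ[R] M := DirectSum.toModule R ι M s ∘ₗ e.symm.toLinearMap
  have h : T.mkQ ∘ₗ DirectSum.toModule R ι M s = DirectSum.coeLinearMap U := by
    refine DirectSum.linearMap_ext R fun i ↦ LinearMap.ext fun u ↦ ?_
    have hu : T.mkQ (s i u) = u := LinearMap.congr_fun (hs i) u
    rw [LinearMap.comp_apply, LinearMap.comp_apply, LinearMap.comp_apply, DirectSum.toModule_lof,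
      hu, DirectSum.lof_eq_of, DirectSum.coeLinearMap_of]
  have hg : ∀ x, T.mkQ (g x) = x := fun x ↦
    (LinearMap.congr_fun h (e.symm x)).trans (e.apply_symm_apply x)
  exact ⟨_, Submodule.isCompl_range_of_mkQ_section hg⟩
end

section
/- Let R be a commutative ring and S a regular multiplicative subset of R such that the localization R_S is a semisimple ring. Then for every S-h-divisible R-module M, the S-torsion submodule of M is a direct summand of M. -/
/-- The preimage of the `S`-torsion submodule under an `R`-linear map out of a module over the
localization `R_S`, as an `R_S`-submodule. -/
def torsionComap {R : Type*} [CommRing R] (S : Submonoid R) {F M : Type*}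
    [AddCommGroup F] [Module R F] [Module (Localization S) F] [IsScalarTower R (Localization S) F]
    [AddCommGroup M] [Module R M] (φ : F →ₗ[R] M) : Submodule (Localization S) F where
  __ := (Submodule.torsion' R M S).comap φ
  smul_mem' q x hx := by
    obtain ⟨⟨r, s⟩, hq⟩ := IsLocalization.surj S q
    obtain ⟨t, ht⟩ := hx
    have hqx : (s : R) • q • x = r • x := by
      rw [← IsScalarTower.algebraMap_smul (Localization S) (s : R), smul_smul, mul_comm, hq,
        IsScalarTower.algebraMap_smul]
    refine ⟨t * s, ?_⟩
    change t • φ x = 0 at ht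
    change (t * s) • φ (q • x) = 0
    rw [mul_smul, Submonoid.smul_def s, ← map_smul, hqx, map_smul, smul_comm, ht, smul_zero]

/-- The `S`-torsion submodule of an `R`-linear image of a semisimple `R_S`-module is a direct
summand. -/
theorem exists_isCompl_torsion'_of_surjective {R : Type*} [CommRing R] (S : Submonoid R)
    {F M : Type*} [AddCommGroup F] [Module R F] [Module (Localization S) F]
    [IsScalarTower R (Localization S) F] [IsSemisimpleModule (Localization S) F]
    [AddCommGroup M] [Module R M] (φ : F →ₗ[R] M) (hφ : Function.Surjective φ) :
    ∃ C : Submodule R M, IsCompl (Submodule.torsion' R M S) C := by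
  obtain ⟨C, hC⟩ := exists_isCompl (torsionComap S φ)
  refine ⟨(C.restrictScalars R).map φ, ?_, ?_⟩
  · rw [Submodule.disjoint_def]
    rintro _ hT ⟨c, hc, rfl⟩
    rw [Submodule.disjoint_def.mp hC.disjoint c hT hc, map_zero]
  · rw [codisjoint_iff, eq_top_iff]
    intro m _
    obtain ⟨x, rfl⟩ := hφ m
    obtain ⟨k, hk, c, hc, rfl⟩ :=
      Submodule.mem_sup.mp (hC.sup_eq_top.ge (Submodule.mem_top (x := x)))
    rw [map_add]
    exact Submodule.add_mem_sup hk ⟨c, hc, rfl⟩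

/-- If `S` is a regular multiplicative subset of `R` such that `R_S` is a semisimple ring,
then the `S`-torsion submodule of any `S`-`h`-divisible `R`-module is a direct summand. -/
theorem torsion_summand_of_sHDivisible (R : Type) [CommRing R] (S : Submonoid R)
    (hreg : S ≤ nonZeroDivisors R) [IsSemisimpleRing (Localization S)]
    (M : Type) [AddCommGroup M] [Module R M] (hM : SHDivisible R S M) :
    ∃ C : Submodule R M, IsCompl (Submodule.torsion' R M S) C := by
  exact exists_isCompl_torsion'_of_surjective S
    (Finsupp.lsum R fun f : Localization S →ₗ[R] M => f)
    (LinearMap.range_eq_top.mp (eq_top_iff.mpr (hM.ge.trans (iSup_le fun f => by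
      rintro _ ⟨x, rfl⟩
      exact ⟨Finsupp.single f x, by simp⟩))))
end

section
/- Let R be a commutative ring, S a multiplicative subset of R, T an S-torsion R-module, and M any R-module. Then Hom_R(T, M) is S-h-reduced, i.e., Hom_R(R_S, Hom_R(T, M)) = 0, and Hom_R(T, M) is S-weakly cotorsion, i.e., Ext^1_R(R_S, Hom_R(T, M)) = 0. -/
open scoped TensorProduct

/-- The tensor product of an `S`-torsion module with the localization at `S` vanishes. -/
lemma STorsion.subsingleton_tensorProduct_localization {R : Type} [CommRing R] {S : Submonoid R}
    {T : Type} [AddCommGroup T] [Module R T] (hT : STorsion R S T) :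
    Subsingleton (T ⊗[R] Localization S) := by
  refine subsingleton_of_forall_eq 0 fun z ↦ ?_
  induction z with
  | zero => rfl
  | add x y hx hy => rw [hx, hy, add_zero]
  | tmul t q =>
    obtain ⟨s, hs, hst⟩ := hT t
    obtain ⟨q', rfl⟩ : ∃ q' : Localization S, s • q' = q :=
      ⟨Localization.mk 1 ⟨s, hs⟩ * q, by
        rw [← smul_mul_assoc, Localization.smul_mk, smul_eq_mul, mul_one,
          Localization.mk_self (⟨s, hs⟩ : S), one_mul]⟩
    rw [← TensorProduct.smul_tmul, hst, TensorProduct.zero_tmul]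

/-- A linear map `i : Hom(T, M) → X` which becomes bijective after tensoring with `T` has a
retraction. -/
lemma LinearMap.exists_leftInverse_of_bijective_lTensor {R T M X : Type*} [CommRing R]
    [AddCommGroup T] [Module R T] [AddCommGroup M] [Module R M] [AddCommGroup X] [Module R X]
    (i : (T →ₗ[R] M) →ₗ[R] X) (hi : Function.Bijective (i.lTensor T)) :
    ∃ l : X →ₗ[R] T →ₗ[R] M, l ∘ₗ i = LinearMap.id := by
  let e := LinearEquiv.ofBijective (i.lTensor T) hi
  let ev : T ⊗[R] (T →ₗ[R] M) →ₗ[R] M := TensorProduct.lift LinearMap.id.flip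
  refine ⟨(TensorProduct.curry (ev ∘ₗ e.symm.toLinearMap)).flip, ?_⟩
  ext f t
  have h : e.symm (t ⊗ₜ[R] i f) = t ⊗ₜ[R] f := (LinearEquiv.symm_apply_eq e).2 rfl
  simp [h, ev]

/-- If `T` is an `S`-torsion `R`-module, then for every `R`-module `M` the module
`Hom_R(T, M)` is `S`-`h`-reduced (i.e. `Hom_R(R_S, Hom_R(T, M)) = 0`) and `S`-weakly
cotorsion (i.e. `Ext¹_R(R_S, Hom_R(T, M)) = 0`). -/
theorem hom_from_torsion_sHReduced_and_sWeaklyCotorsion (R : Type) [CommRing R]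
    (S : Submonoid R) (T : Type) [AddCommGroup T] [Module R T] (hT : STorsion R S T)
    (M : Type) [AddCommGroup M] [Module R M] :
    (∀ f : Localization S →ₗ[R] (T →ₗ[R] M), f = 0) ∧
    SWeaklyCotorsion R S (T →ₗ[R] M) := by
  have := hT.subsingleton_tensorProduct_localization
  refine ⟨fun f ↦ ?_, fun X _ _ i p hi hp hip ↦ ?_⟩
  · ext q t
    have h : TensorProduct.lift f.flip (t ⊗ₜ[R] q) = 0 := by
      rw [Subsingleton.elim (t ⊗ₜ[R] q) 0, map_zero]
    simpa using h
  · have hex : Function.Exact i p := LinearMap.exact_iff.2 hip.symm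
    have : Module.Flat R (Localization S) := IsLocalization.flat _ S
    have hinj := LinearMap.lTensor_injective_of_exact_of_flat p hp i hi hex T
    have hsurj : Function.Surjective (i.lTensor T) := fun x ↦
      (lTensor_exact T hex hp x).1 (Subsingleton.elim _ _)
    exact ((hex.split_tfae hi hp).out 0 1).2
      (i.exists_leftInverse_of_bijective_lTensor ⟨hinj, hsurj⟩)
end

section
/- Let R be a commutative ring, S a regular multiplicative subset of R, and D an S-torsion S-h-divisible R-module. Then the evaluation map ε : Hom_R(R_S, D) → D, ε(f) = f(1), is surjective, and its kernel is isomorphic to Hom_R(R_S/R, D) (via the map induced by the quotient R_S → R_S/R); that is, there is a short exact sequence 0 → Hom_R(R_S/R, D) → Hom_R(R_S, D) → D → 0. -/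
/-- The cokernel `R_S/R` of the natural map `R → R_S`. -/
abbrev LocModR (R : Type) [CommRing R] (S : Submonoid R) :=
  Localization S ⧸ LinearMap.range (Algebra.linearMap R (Localization S))

/-- The evaluation-at-`1` map `ε : Hom_R(R_S, D) → D`. -/
noncomputable def evalOne (R : Type) [CommRing R] (S : Submonoid R)
    (D : Type) [AddCommGroup D] [Module R D] :
    (Localization S →ₗ[R] D) →ₗ[R] D :=
  LinearMap.applyₗ (1 : Localization S)

/-- Precomposition with the quotient map `R_S → R_S/R`, giving
`Hom_R(R_S/R, D) → Hom_R(R_S, D)`. -/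
noncomputable def homMkQ (R : Type) [CommRing R] (S : Submonoid R)
    (D : Type) [AddCommGroup D] [Module R D] :
    (LocModR R S →ₗ[R] D) →ₗ[R] (Localization S →ₗ[R] D) :=
  LinearMap.lcomp R D (LinearMap.range (Algebra.linearMap R (Localization S))).mkQ

/-- For `S` regular and `D` an `S`-torsion `S`-`h`-divisible `R`-module, evaluation at `1`
is surjective and its kernel is the image of `Hom_R(R_S/R, D)`, i.e. there is a short exact
sequence `0 → Hom_R(R_S/R, D) → Hom_R(R_S, D) → D → 0`. -/
theorem evalOne_exact_sequence (R : Type) [CommRing R] (S : Submonoid R)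
    (hreg : S ≤ nonZeroDivisors R)
    (D : Type) [AddCommGroup D] [Module R D]
    (htor : STorsion R S D) (hdiv : SHDivisible R S D) :
    Function.Surjective (evalOne R S D) ∧
    Function.Injective (homMkQ R S D) ∧
    LinearMap.range (homMkQ R S D) = LinearMap.ker (evalOne R S D) := by
  refine ⟨?_, ?_, ?_⟩
  · rw [← LinearMap.range_eq_top, ← top_le_iff]
    refine hdiv.ge.trans (iSup_le fun f => ?_)
    rintro _ ⟨x, rfl⟩
    exact ⟨f ∘ₗ LinearMap.mulLeft R x, by simp [evalOne]⟩
  · intro f g h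
    exact Submodule.linearMap_qext _ h
  · ext f
    constructor
    · rintro ⟨g, rfl⟩
      have h1 : (LinearMap.range (Algebra.linearMap R (Localization S))).mkQ 1 = 0 :=
        (Submodule.Quotient.mk_eq_zero _).2 ⟨1, by simp⟩
      exact (congrArg g h1).trans (map_zero g)
    · intro hf
      have hf : f 1 = 0 := hf
      have hle : LinearMap.range (Algebra.linearMap R (Localization S)) ≤ LinearMap.ker f := by
        rintro _ ⟨r, rfl⟩
        simp [Algebra.algebraMap_eq_smul_one, hf]
      exact ⟨Submodule.liftQ _ f hle, Submodule.liftQ_mkQ _ f hle⟩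
end

section
/- Let R be a commutative ring and S a regular multiplicative subset of R. Then every R-module that is both S-divisible and S-strongly flat is S-h-divisible. -/
/-- A module annihilated by some `s ∈ S` is `S`-weakly cotorsion: on an extension `X` of `R_S` by it,
multiplication by `s` factors through `R_S`, where `s` is invertible. -/
theorem SWeaklyCotorsion.of_smul_eq_zero {R : Type} [CommRing R] {S : Submonoid R}
    {N : Type} [AddCommGroup N] [Module R N] {s : R} (hs : s ∈ S) (hN : ∀ n : N, s • n = 0) :
    SWeaklyCotorsion R S N := by
  intro X _ _ i p _ hp hip
  have hker : LinearMap.ker p ≤ LinearMap.ker (LinearMap.lsmul R X s) := by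
    rw [← hip]
    rintro _ ⟨n, rfl⟩
    simp [← map_smul, hN]
  let h : Localization S →ₗ[R] X :=
    (LinearMap.ker p).liftQ (LinearMap.lsmul R X s) hker ∘ₗ
      (p.quotKerEquivOfSurjective hp).symm.toLinearMap
  have hh (x : X) : h (p x) = s • x := by
    have : (p.quotKerEquivOfSurjective hp).symm (p x) = Submodule.Quotient.mk x :=
      (LinearEquiv.symm_apply_eq _).2 rfl
    simp [h, this]
  refine ⟨h ∘ₗ LinearMap.mulLeft R (Localization.mk 1 ⟨s, hs⟩), LinearMap.ext fun y => ?_⟩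
  obtain ⟨x, hx⟩ := hp (Localization.mk 1 ⟨s, hs⟩ * y)
  have hinv : s • (Localization.mk 1 ⟨s, hs⟩ : Localization S) = 1 := by
    rw [Localization.smul_mk, smul_eq_mul, mul_one]
    exact Localization.mk_self ⟨s, hs⟩
  simp only [LinearMap.comp_apply, LinearMap.mulLeft_apply, LinearMap.id_apply]
  rw [← hx, hh, map_smul, hx, ← smul_mul_assoc, hinv, one_mul]

/-- On an `S`-divisible `S`-strongly flat module every `s ∈ S` acts injectively: the extension
`0 → M[s] → M → M → 0` given by multiplication by `s` splits. -/
theorem SStronglyFlat.smul_injective_of_sDivisible {R : Type} [CommRing R] {S : Submonoid R}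
    {M : Type} [AddCommGroup M] [Module R M] (hsf : SStronglyFlat R S M)
    (hdiv : SDivisible R S M) {s : R} (hs : s ∈ S) :
    Function.Injective fun m : M => s • m := by
  let p : M →ₗ[R] M := LinearMap.lsmul R M s
  have hN : SWeaklyCotorsion R S (LinearMap.ker p) :=
    .of_smul_eq_zero hs fun n => Subtype.ext n.2
  obtain ⟨t, ht⟩ := hsf _ hN M (LinearMap.ker p).subtype p
    (LinearMap.ker p).injective_subtype (hdiv s hs) (Submodule.range_subtype _)
  have ht' (m : M) : t (s • m) = m := by
    rw [map_smul]
    exact LinearMap.congr_fun ht m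
  exact Function.LeftInverse.injective ht'

/-- Over a commutative ring `R` with regular multiplicative subset `S`, every `S`-divisible
`S`-strongly flat `R`-module is `S`-`h`-divisible. -/
theorem sHDivisible_of_sDivisible_sStronglyFlat (R : Type) [CommRing R] (S : Submonoid R)
    (hreg : S ≤ nonZeroDivisors R)
    (M : Type) [AddCommGroup M] [Module R M]
    (hdiv : SDivisible R S M) (hsf : SStronglyFlat R S M) :
    SHDivisible R S M := by
  have hunit (s : S) : IsUnit (algebraMap R (Module.End R M) s) :=
    (Module.End.isUnit_iff _).2
      ⟨hsf.smul_injective_of_sDivisible hdiv s.2, hdiv s s.2⟩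
  refine eq_top_iff.2 fun m _ => ?_
  let f : Localization S →ₗ[R] M := IsLocalizedModule.lift S
    (Algebra.linearMap R (Localization S)) (LinearMap.toSpanSingleton R M m) hunit
  have hf : f 1 = m := by
    simpa using IsLocalizedModule.lift_apply S (Algebra.linearMap R (Localization S))
      (LinearMap.toSpanSingleton R M m) hunit 1
  exact le_iSup (fun f : Localization S →ₗ[R] M => LinearMap.range f) f ⟨1, hf⟩
end

section
/- Let R be a commutative ring and S a regular multiplicative subset of R. An R-module F is S-strongly flat if and only if F is a direct summand of an R-module G that fits in a short exact sequence 0 → U → G → V → 0 of R-modules in which U is a free R-module and V is a free R_S-module. -/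
section Extensions

variable {R : Type} [CommRing R]
  {A B C X Y : Type} [AddCommGroup A] [Module R A] [AddCommGroup B] [Module R B]
  [AddCommGroup C] [Module R C] [AddCommGroup X] [Module R X] [AddCommGroup Y] [Module R Y]

theorem LinearMap.exists_comp_eq_of_range_le (b : B →ₗ[R] X) (hb : Function.Injective b)
    (g : A →ₗ[R] X) (hg : ∀ a, g a ∈ LinearMap.range b) : ∃ h : A →ₗ[R] B, b ∘ₗ h = g := by
  refine ⟨(LinearEquiv.ofInjective b hb).symm.toLinearMap ∘ₗ g.codRestrict _ hg, ?_⟩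
  ext a
  exact congrArg Subtype.val
    ((LinearEquiv.ofInjective b hb).apply_symm_apply (g.codRestrict _ hg a))

theorem LinearMap.exists_comp_eq_of_ker_le (q : X →ₗ[R] C) (hq : Function.Surjective q)
    (g : X →ₗ[R] Y) (hg : ∀ x, q x = 0 → g x = 0) : ∃ h : C →ₗ[R] Y, h ∘ₗ q = g := by
  have hker : LinearMap.ker q ≤ LinearMap.ker g := fun x hx => hg x hx
  refine ⟨(LinearMap.ker q).liftQ g hker ∘ₗ
    (q.quotKerEquivOfSurjective hq).symm.toLinearMap, ?_⟩
  ext x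
  have : (q.quotKerEquivOfSurjective hq).symm (q x) = (LinearMap.ker q).mkQ x := by
    rw [LinearEquiv.symm_apply_eq]; rfl
  simp [this]

/-- The pushout of a short exact sequence `K → X → C` along `f : K → B`. -/
theorem exists_pushout_extension {K : Type} [AddCommGroup K] [Module R K]
    (i : K →ₗ[R] X) (q : X →ₗ[R] C) (f : K →ₗ[R] B)
    (hi : Function.Injective i) (hq : Function.Surjective q)
    (hiq : LinearMap.range i = LinearMap.ker q) :
    ∃ (Q : Type) (_ : AddCommGroup Q) (_ : Module R Q)
      (b : B →ₗ[R] Q) (x : X →ₗ[R] Q) (p : Q →ₗ[R] C),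
      Function.Injective b ∧ Function.Surjective p ∧ LinearMap.range b = LinearMap.ker p ∧
      (∀ k, b (f k) = x (i k)) ∧ (∀ y, p (x y) = q y) ∧
      ∀ (D : Type) [AddCommGroup D] [Module R D] (g : B →ₗ[R] D) (h : X →ₗ[R] D),
        (∀ k, g (f k) = h (i k)) →
          ∃ d : Q →ₗ[R] D, (∀ y, d (b y) = g y) ∧ ∀ y, d (x y) = h y := by
  let W : Submodule R (B × X) := LinearMap.range (f.prod (-i))
  have hqi : ∀ k, q (i k) = 0 := fun k => by
    rw [← LinearMap.mem_ker, ← hiq]; exact ⟨k, rfl⟩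
  have univ : ∀ (D : Type) [AddCommGroup D] [Module R D] (g : B →ₗ[R] D) (h : X →ₗ[R] D),
      (∀ k, g (f k) = h (i k)) → W ≤ LinearMap.ker (g.coprod h) := by
    rintro D _ _ g h hgh _ ⟨k, rfl⟩
    simp [hgh]
  have hW := univ C 0 q (fun k => by simp [hqi])
  refine ⟨(B × X) ⧸ W, inferInstance, inferInstance, W.mkQ ∘ₗ LinearMap.inl R B X,
    W.mkQ ∘ₗ LinearMap.inr R B X, W.liftQ _ hW, ?_, ?_, ?_, ?_, ?_, ?_⟩
  · rw [← LinearMap.ker_eq_bot, LinearMap.ker_eq_bot']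
    intro y hy
    obtain ⟨k, hk⟩ := (Submodule.Quotient.mk_eq_zero W).1 hy
    have h1 : f k = y := congrArg Prod.fst hk
    have h2 : i k = 0 := neg_eq_zero.1 (congrArg Prod.snd hk)
    rw [← h1, hi (h2.trans (map_zero i).symm), map_zero]
  · intro c
    obtain ⟨y, rfl⟩ := hq c
    exact ⟨W.mkQ (0, y), by simp⟩
  · ext z
    constructor
    · rintro ⟨y, rfl⟩
      simp
    · intro hz
      obtain ⟨⟨y, w⟩, rfl⟩ := W.mkQ_surjective z
      have hw : w ∈ LinearMap.ker q := by simpa using hz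
      rw [← hiq] at hw
      obtain ⟨k, rfl⟩ := hw
      refine ⟨y + f k, (Submodule.Quotient.eq W).2 ⟨k, ?_⟩⟩
      simp
  · intro k
    exact (Submodule.Quotient.eq W).2 ⟨k, by simp⟩
  · intro y
    simp
  · intro D _ _ g h hgh
    exact ⟨W.liftQ _ (univ D g h hgh), by simp, by simp⟩

theorem Ext1Vanishes.exists_extend (h : Ext1Vanishes R C B) {K : Type} [AddCommGroup K]
    [Module R K] (i : K →ₗ[R] X) (q : X →ₗ[R] C) (hi : Function.Injective i)
    (hq : Function.Surjective q) (hiq : LinearMap.range i = LinearMap.ker q) (f : K →ₗ[R] B) :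
    ∃ e : X →ₗ[R] B, ∀ k, e (i k) = f k := by
  obtain ⟨Q, _, _, b, x, p, hb, hp, hbp, hfx, hpx, -⟩ := exists_pushout_extension i q f hi hq hiq
  obtain ⟨s, hs⟩ := h Q b p hb hp hbp
  obtain ⟨e, he⟩ := LinearMap.exists_comp_eq_of_range_le b hb (x - s ∘ₗ q) (fun y => by
    rw [hbp, LinearMap.mem_ker]
    have := LinearMap.congr_fun hs (q y)
    simp only [LinearMap.comp_apply, LinearMap.id_apply] at this
    simp [hpx, this])
  refine ⟨e, fun k => hb ?_⟩
  have hk : q (i k) = 0 := by rw [← LinearMap.mem_ker, ← hiq]; exact ⟨k, rfl⟩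
  have := LinearMap.congr_fun he (i k)
  simpa [hk, hfx] using this

theorem ext1Vanishes_of_exists_extend {K : Type} [AddCommGroup K] [Module R K]
    [Module.Projective R X] (i : K →ₗ[R] X) (q : X →ₗ[R] C) (hq : Function.Surjective q)
    (hiq : LinearMap.range i = LinearMap.ker q)
    (h : ∀ f : K →ₗ[R] B, ∃ e : X →ₗ[R] B, ∀ k, e (i k) = f k) : Ext1Vanishes R C B := by
  intro Z _ _ b p hb hp hbp
  obtain ⟨t, ht⟩ := Module.projective_lifting_property p q hp
  have ht' : ∀ y, p (t y) = q y := fun y => LinearMap.congr_fun ht y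
  have hqi : ∀ k, q (i k) = 0 := fun k => by
    rw [← LinearMap.mem_ker, ← hiq]; exact ⟨k, rfl⟩
  obtain ⟨f, hf⟩ := LinearMap.exists_comp_eq_of_range_le b hb (t ∘ₗ i) (fun k => by
    rw [hbp, LinearMap.mem_ker]; simp [ht', hqi])
  obtain ⟨e, he⟩ := h f
  obtain ⟨s, hs⟩ := LinearMap.exists_comp_eq_of_ker_le q hq (t - b ∘ₗ e) (fun y hy => by
    rw [← LinearMap.mem_ker, ← hiq] at hy
    obtain ⟨k, rfl⟩ := hy
    have := LinearMap.congr_fun hf k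
    simp only [LinearMap.comp_apply] at this
    simp [he, this])
  refine ⟨s, LinearMap.ext fun c => ?_⟩
  obtain ⟨y, rfl⟩ := hq c
  have hpb : p (b (e y)) = 0 := by rw [← LinearMap.mem_ker, ← hbp]; exact ⟨_, rfl⟩
  have := LinearMap.congr_fun hs y
  simp only [LinearMap.comp_apply] at this
  simp [this, ht', hpb]

theorem Ext1Vanishes.exists_lift (h : Ext1Vanishes R A B) (i : B →ₗ[R] X) (q : X →ₗ[R] C)
    (hi : Function.Injective i) (hq : Function.Surjective q)
    (hiq : LinearMap.range i = LinearMap.ker q) (g : A →ₗ[R] C) :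
    ∃ e : A →ₗ[R] X, q ∘ₗ e = g := by
  have hqi : ∀ k, q (i k) = 0 := fun k => by
    rw [← LinearMap.mem_ker, ← hiq]; exact ⟨k, rfl⟩
  let P : Submodule R (A × X) :=
    LinearMap.eqLocus (g ∘ₗ LinearMap.fst R A X) (q ∘ₗ LinearMap.snd R A X)
  obtain ⟨s, hs⟩ := h P ((LinearMap.inr R A X ∘ₗ i).codRestrict P (fun b => by
      change g 0 = q (i b); simp [hqi])) (LinearMap.fst R A X ∘ₗ P.subtype)
    (fun x y hxy => hi (congrArg (fun z : P => z.1.2) hxy))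
    (fun a => by
      obtain ⟨y, hy⟩ := hq (g a)
      exact ⟨⟨(a, y), hy.symm⟩, rfl⟩)
    (by
      ext ⟨⟨a, y⟩, hay⟩
      change g a = q y at hay
      constructor
      · rintro ⟨b, hb⟩
        exact (congrArg (fun z : P => z.1.1) hb).symm
      · intro ha
        change a = 0 at ha
        subst ha
        have hy : y ∈ LinearMap.ker q := by rw [LinearMap.mem_ker, ← hay, map_zero]
        rw [← hiq] at hy
        obtain ⟨b, rfl⟩ := hy
        exact ⟨b, rfl⟩)
  refine ⟨LinearMap.snd R A X ∘ₗ P.subtype ∘ₗ s, LinearMap.ext fun a => ?_⟩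
  have h1 : g (s a).1.1 = q (s a).1.2 := (s a).2
  have h2 : (s a).1.1 = a := LinearMap.congr_fun hs a
  rw [h2] at h1
  exact h1.symm

theorem ext1Vanishes_of_exists_lift [Module.Injective R X] (i : B →ₗ[R] X) (q : X →ₗ[R] C)
    (hi : Function.Injective i) (hiq : LinearMap.range i = LinearMap.ker q)
    (h : ∀ g : A →ₗ[R] C, ∃ e : A →ₗ[R] X, q ∘ₗ e = g) : Ext1Vanishes R A B := by
  intro Z _ _ b p hb hp hbp
  have hqi : ∀ k, q (i k) = 0 := fun k => by
    rw [← LinearMap.mem_ker, ← hiq]; exact ⟨k, rfl⟩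
  have hpb : ∀ k, p (b k) = 0 := fun k => by
    rw [← LinearMap.mem_ker, ← hbp]; exact ⟨k, rfl⟩
  obtain ⟨t, ht⟩ := Module.Injective.out b hb i
  obtain ⟨g, hg⟩ := LinearMap.exists_comp_eq_of_ker_le p hp (q ∘ₗ t) (fun z hz => by
    rw [← LinearMap.mem_ker, ← hbp] at hz
    obtain ⟨k, rfl⟩ := hz
    simp [ht, hqi])
  obtain ⟨e, he⟩ := h g
  obtain ⟨r, hr⟩ := LinearMap.exists_comp_eq_of_range_le i hi (t - e ∘ₗ p) (fun z => by
    rw [hiq, LinearMap.mem_ker]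
    have h1 := LinearMap.congr_fun he (p z)
    have h2 := LinearMap.congr_fun hg z
    simp only [LinearMap.comp_apply] at h1 h2
    simp [h1, h2])
  have hrb : ∀ k, r (b k) = k := fun k => hi (by
    have := LinearMap.congr_fun hr (b k)
    simpa [ht, hpb] using this)
  obtain ⟨s, hs⟩ := LinearMap.exists_comp_eq_of_ker_le p hp (LinearMap.id - b ∘ₗ r)
    (fun z hz => by
      rw [← LinearMap.mem_ker, ← hbp] at hz
      obtain ⟨k, rfl⟩ := hz
      simp [hrb])
  refine ⟨s, LinearMap.ext fun a => ?_⟩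
  obtain ⟨z, rfl⟩ := hp a
  have := LinearMap.congr_fun hs z
  simp only [LinearMap.comp_apply] at this
  simp [this, hpb]

theorem exists_kernel (q : X →ₗ[R] C) :
    ∃ (L : Type) (_ : AddCommGroup L) (_ : Module R L) (i : L →ₗ[R] X),
      Function.Injective i ∧ LinearMap.range i = LinearMap.ker q :=
  ⟨LinearMap.ker q, inferInstance, inferInstance, (LinearMap.ker q).subtype,
    Submodule.injective_subtype _, Submodule.range_subtype _⟩

theorem exists_embedding_injective (R : Type) [CommRing R] (B : Type) [AddCommGroup B]
    [Module R B] : ∃ (E : Type) (_ : AddCommGroup E) (_ : Module R E) (i : B →ₗ[R] E),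
      Module.Injective R E ∧ Function.Injective i := by
  let E := CategoryTheory.Injective.under (ModuleCat.of R B)
  let i : ModuleCat.of R B ⟶ E := CategoryTheory.Injective.ι _
  refine ⟨E, inferInstance, inferInstance, i.hom, ?_, ?_⟩
  · exact (Module.injective_iff_injective_object R E).2
      (inferInstanceAs (CategoryTheory.Injective E))
  · exact (ModuleCat.mono_iff_injective i).1 inferInstance

end Extensions

/-- Modules over the localization at `S` are `S`-weakly cotorsion. -/
theorem sWeaklyCotorsion_of_module_localization (R : Type) [CommRing R] (S : Submonoid R)
    (V : Type) [AddCommGroup V] [Module R V] [Module (Localization S) V]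
    [IsScalarTower R (Localization S) V] : SWeaklyCotorsion R S V := by
  intro X _ _ i p hi hp hip
  have bijL : ∀ s : S, Function.Bijective fun z : Localization S => (s : R) • z := fun s =>
    (Module.End.isUnit_iff _).1
      (IsLocalizedModule.map_units (Algebra.linearMap R (Localization S)) s)
  have bijV : ∀ s : S, Function.Bijective fun z : V => (s : R) • z := fun s => by
    have := (Module.End.isUnit_iff _).1 ((IsLocalization.map_units (Localization S) s).map
      (algebraMap (Localization S) (Module.End (Localization S) V)))
    have heq : (fun z : V => (s : R) • z) =
        algebraMap (Localization S) (Module.End (Localization S) V)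
          (algebraMap R (Localization S) s) := by
      ext z
      simp
    rwa [heq]
  have hunit : ∀ s : S, IsUnit (algebraMap R (Module.End R X) s) := by
    intro s
    rw [Module.End.isUnit_iff]
    constructor
    · rw [← LinearMap.ker_eq_bot, LinearMap.ker_eq_bot']
      intro x hx
      change (s : R) • x = 0 at hx
      have hx' : x ∈ LinearMap.ker p := (bijL s).1 (by
        change (s : R) • p x = (s : R) • 0
        rw [← map_smul, hx, map_zero, smul_zero])
      rw [← hip] at hx'
      obtain ⟨v, rfl⟩ := hx'
      rw [← map_smul] at hx
      have hv : (s : R) • v = 0 := hi (hx.trans (map_zero i).symm)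
      have hv' : v = 0 := (bijV s).1 (hv.trans (smul_zero _).symm)
      rw [hv', map_zero]
    · intro x
      obtain ⟨c, hc⟩ := (bijL s).2 (p x)
      obtain ⟨y, rfl⟩ := hp c
      have hy : x - (s : R) • y ∈ LinearMap.ker p := by
        change (s : R) • p y = p x at hc
        simp [hc]
      rw [← hip] at hy
      obtain ⟨v, hv⟩ := hy
      obtain ⟨w, rfl⟩ := (bijV s).2 v
      refine ⟨i w + y, ?_⟩
      change (s : R) • (i w + y) = x
      rw [smul_add, ← map_smul]
      exact eq_sub_iff_add_eq.1 hv
  obtain ⟨x, hx⟩ := hp 1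
  refine ⟨IsLocalizedModule.lift S (Algebra.linearMap R (Localization S))
    (LinearMap.toSpanSingleton R X x) hunit, ?_⟩
  apply IsLocalizedModule.ext S (Algebra.linearMap R (Localization S))
    (IsLocalizedModule.map_units (Algebra.linearMap R (Localization S)))
  rw [LinearMap.comp_assoc, IsLocalizedModule.lift_comp]
  ext
  simp [hx]

/-- Every module embeds in an `S`-weakly cotorsion module with cokernel a direct sum of
copies of the localization. -/
theorem exists_sWeaklyCotorsion_extension (R : Type) [CommRing R] (S : Submonoid R)
    (K : Type) [AddCommGroup K] [Module R K] :
    ∃ (I : Type) (N : Type) (_ : AddCommGroup N) (_ : Module R N)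
      (b : K →ₗ[R] N) (p : N →ₗ[R] (I →₀ Localization S)),
      Function.Injective b ∧ Function.Surjective p ∧ LinearMap.range b = LinearMap.ker p ∧
      SWeaklyCotorsion R S N := by
  let q : (Localization S →₀ R) →ₗ[R] Localization S := Finsupp.linearCombination R id
  have hq : Function.Surjective q := Finsupp.linearCombination_id_surjective R _
  obtain ⟨L, _, _, i, hi, hL⟩ := exists_kernel q
  obtain ⟨N, _, _, b, x, p, hb, hp, hbp, hfx, hpx, -⟩ := exists_pushout_extension
    (K := (L →ₗ[R] K) →₀ L) (X := (L →ₗ[R] K) →₀ Localization S →₀ R)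
    (C := (L →ₗ[R] K) →₀ Localization S)
    (Finsupp.mapRange.linearMap i) (Finsupp.mapRange.linearMap q)
    (Finsupp.lsum R (fun φ : L →ₗ[R] K => φ))
    (Finsupp.mapRange_injective _ (map_zero _) hi)
    (Finsupp.mapRange_surjective _ (map_zero _) hq)
    (by rw [Finsupp.range_mapRange_linearMap _ (LinearMap.ker_eq_bot.2 hi),
          Finsupp.ker_mapRange, hL])
  refine ⟨L →ₗ[R] K, N, inferInstance, inferInstance, b, p, hb, hp, hbp, ?_⟩
  refine ext1Vanishes_of_exists_extend i q hq hL fun f => ?_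
  obtain ⟨e, he⟩ := (sWeaklyCotorsion_of_module_localization R S
    ((L →ₗ[R] K) →₀ Localization S)).exists_extend i q hi hq hL (p ∘ₗ f)
  obtain ⟨t, ht⟩ := Module.projective_lifting_property p e hp
  obtain ⟨φ, hφ⟩ := LinearMap.exists_comp_eq_of_range_le b hb (f - t ∘ₗ i) (fun k => by
    rw [hbp, LinearMap.mem_ker]
    have h1 := LinearMap.congr_fun ht (i k)
    have h2 := he k
    simp only [LinearMap.comp_apply] at h1 h2
    rw [LinearMap.sub_apply, LinearMap.comp_apply, map_sub, h1, h2, sub_self])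
  refine ⟨t + x ∘ₗ Finsupp.lsingle φ, fun k => ?_⟩
  have h1 := hfx (Finsupp.single φ k)
  have h2 := LinearMap.congr_fun hφ k
  simp only [LinearMap.comp_apply, LinearMap.sub_apply, Finsupp.mapRange.linearMap_apply,
    Finsupp.mapRange_single, Finsupp.lsum_single] at h1 h2
  rw [LinearMap.add_apply, LinearMap.comp_apply, Finsupp.lsingle_apply, ← h1, h2,
    add_sub_cancel]

theorem SStronglyFlat.exists_summand {R : Type} [CommRing R] {S : Submonoid R}
    {F : Type} [AddCommGroup F] [Module R F] (hF : SStronglyFlat R S F) :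
    ∃ (G : Type) (_ : AddCommGroup G) (_ : Module R G) (I : Type)
      (u : (F →₀ R) →ₗ[R] G) (v : G →ₗ[R] (I →₀ Localization S)),
      Function.Injective u ∧ Function.Surjective v ∧ LinearMap.range u = LinearMap.ker v ∧
      ∃ (j : F →ₗ[R] G) (p : G →ₗ[R] F), p ∘ₗ j = LinearMap.id := by
  let q : (F →₀ R) →ₗ[R] F := Finsupp.linearCombination R id
  have hq : Function.Surjective q := Finsupp.linearCombination_id_surjective R _
  obtain ⟨K, _, _, i, hi, hK⟩ := exists_kernel q
  obtain ⟨I, N, _, _, b, v, hb, hv, hbv, hN⟩ := exists_sWeaklyCotorsion_extension R S K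
  obtain ⟨e, he⟩ := (hF N hN).exists_extend i q hi hq hK b
  obtain ⟨G, _, _, u, x, w, hu, hw, huw, hux, -, huniv⟩ :=
    exists_pushout_extension b v i hb hv hbv
  obtain ⟨p, hpu, hpx⟩ := huniv F q 0 (fun k => by
    have hk : i k ∈ LinearMap.ker q := hK ▸ ⟨k, rfl⟩
    simpa using hk)
  obtain ⟨j, hj⟩ := LinearMap.exists_comp_eq_of_ker_le q hq (u - x ∘ₗ e) (fun y hy => by
    rw [← LinearMap.mem_ker, ← hK] at hy
    obtain ⟨k, rfl⟩ := hy
    simp [hux, he])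
  refine ⟨G, inferInstance, inferInstance, I, u, w, hu, hw, huw, j, p, LinearMap.ext fun a => ?_⟩
  obtain ⟨y, rfl⟩ := hq a
  have := LinearMap.congr_fun hj y
  simp only [LinearMap.comp_apply] at this
  simp [this, hpu, hpx]

theorem sStronglyFlat_of_summand {R : Type} [CommRing R] {S : Submonoid R}
    {F G U V : Type} [AddCommGroup F] [Module R F] [AddCommGroup G] [Module R G]
    [AddCommGroup U] [Module R U] [AddCommGroup V] [Module R V]
    [Module (Localization S) V] [IsScalarTower R (Localization S) V]
    [Module.Projective R U] [Module.Free (Localization S) V]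
    (u : U →ₗ[R] G) (v : G →ₗ[R] V) (hu : Function.Injective u) (hv : Function.Surjective v)
    (huv : LinearMap.range u = LinearMap.ker v)
    (j : F →ₗ[R] G) (p : G →ₗ[R] F) (hpj : p ∘ₗ j = LinearMap.id) : SStronglyFlat R S F := by
  intro N _ _ hN
  obtain ⟨E, _, _, i, _, hi⟩ := exists_embedding_injective R N
  let q := (LinearMap.range i).mkQ
  have hq : Function.Surjective q := Submodule.mkQ_surjective _
  have hiq : LinearMap.range i = LinearMap.ker q := (Submodule.ker_mkQ _).symm
  have lift_free : ∀ g : V →ₗ[R] E ⧸ LinearMap.range i, ∃ e : V →ₗ[R] E, q ∘ₗ e = g := by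
    intro g
    let β := (Module.Free.chooseBasis (Localization S) V).repr.restrictScalars R
    choose e he using fun a : Module.Free.ChooseBasisIndex (Localization S) V =>
      Ext1Vanishes.exists_lift hN i q hi hq hiq
        (g ∘ₗ β.symm.toLinearMap ∘ₗ Finsupp.lsingle a)
    have key : q ∘ₗ Finsupp.lsum R e = g ∘ₗ β.symm.toLinearMap :=
      Finsupp.lhom_ext' fun a => by
        rw [LinearMap.comp_assoc, Finsupp.lsum_comp_lsingle, he, LinearMap.comp_assoc]
    refine ⟨Finsupp.lsum R e ∘ₗ β.toLinearMap, LinearMap.ext fun z => ?_⟩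
    simpa using LinearMap.congr_fun key (β z)
  refine ext1Vanishes_of_exists_lift i q hi hiq fun g => ?_
  obtain ⟨t, ht⟩ := Module.projective_lifting_property q (g ∘ₗ p ∘ₗ u) hq
  obtain ⟨t', ht'⟩ := Module.Injective.out u hu t
  obtain ⟨d, hd⟩ := LinearMap.exists_comp_eq_of_ker_le v hv (g ∘ₗ p - q ∘ₗ t') (fun z hz => by
    rw [← LinearMap.mem_ker, ← huv] at hz
    obtain ⟨k, rfl⟩ := hz
    have := LinearMap.congr_fun ht k
    simp only [LinearMap.comp_apply] at this
    simp [ht', this])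
  obtain ⟨e, he⟩ := lift_free d
  refine ⟨(e ∘ₗ v + t') ∘ₗ j, LinearMap.ext fun a => ?_⟩
  have h1 := LinearMap.congr_fun he (v (j a))
  have h2 := LinearMap.congr_fun hd (j a)
  have h3 := LinearMap.congr_fun hpj a
  simp only [LinearMap.comp_apply, LinearMap.sub_apply, LinearMap.id_apply] at h1 h2 h3
  simp [h1, h2, h3]

/-- An `R`-module `F` is `S`-strongly flat iff it is a direct summand of an `R`-module `G`
fitting in a short exact sequence `0 → U → G → V → 0` where `U` is a free `R`-module and
`V` is a free `R_S`-module. -/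
theorem sStronglyFlat_iff_summand (R : Type) [CommRing R] (S : Submonoid R)
    (hreg : S ≤ nonZeroDivisors R)
    (F : Type) [AddCommGroup F] [Module R F] :
    SStronglyFlat R S F ↔
      ∃ (G : Type) (_ : AddCommGroup G) (_ : Module R G)
        (U : Type) (_ : AddCommGroup U) (_ : Module R U)
        (V : Type) (_ : AddCommGroup V) (_ : Module R V)
        (_ : Module (Localization S) V) (_ : IsScalarTower R (Localization S) V)
        (u : U →ₗ[R] G) (v : G →ₗ[R] V),
        Module.Free R U ∧ Module.Free (Localization S) V ∧
        Function.Injective u ∧ Function.Surjective v ∧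
        LinearMap.range u = LinearMap.ker v ∧
        ∃ (j : F →ₗ[R] G) (p : G →ₗ[R] F), p ∘ₗ j = LinearMap.id := by
  constructor
  · intro hF
    obtain ⟨G, _, _, I, u, v, hu, hv, huv, hG⟩ := hF.exists_summand
    exact ⟨G, inferInstance, inferInstance, F →₀ R, inferInstance, inferInstance,
      I →₀ Localization S, inferInstance, inferInstance, inferInstance, inferInstance, u, v,
      inferInstance, inferInstance, hu, hv, huv, hG⟩
  · rintro ⟨G, _, _, U, _, _, V, _, _, _, _, u, v, _, _, hu, hv, huv, j, p, hpj⟩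
    exact sStronglyFlat_of_summand u v hu hv huv j p hpj
end

section
/- Let R = ℤ ⋉ (ℚ/ℤ) be the trivial extension (square-zero extension) of ℤ by the ℤ-module ℚ/ℤ. Then R is not a self-injective ring; concretely, the R-module homomorphism f from the ideal ⟨2⟩ ⋉ (ℚ/ℤ) of R to R defined by f(2n, b/a + ℤ) = (n, b/(2a) + ℤ) cannot be extended to an R-module homomorphism R → R, so R is not injective as a module over itself. -/
/-- `ℚ/ℤ` as a `ℤ`-module. -/
abbrev QmodZ : Type := ℚ ⧸ (Submodule.span ℤ ({1} : Set ℚ))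

noncomputable instance : Module ℤᵐᵒᵖ QmodZ :=
  Module.compHom QmodZ ((RingHom.id ℤ).fromOpposite fun _ _ => mul_comm _ _)

instance : IsCentralScalar ℤ QmodZ := ⟨fun _ _ => rfl⟩

/-- The trivial (square-zero) extension `R = ℤ ⋉ ℚ/ℤ`. -/
abbrev Rtriv : Type := TrivSqZeroExt ℤ QmodZ

/-- The ideal of elements of a commutative ring killed by a power of `a`. -/
def powTorsionIdeal {R : Type*} [CommRing R] (a : R) : Ideal R where
  carrier := {x | ∃ k : ℕ, a ^ k * x = 0}
  zero_mem' := ⟨0, mul_zero _⟩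
  add_mem' := by
    rintro x y ⟨k, hk⟩ ⟨l, hl⟩
    exact ⟨k + l, by linear_combination a ^ l * hk + a ^ k * hl⟩
  smul_mem' := by
    rintro c x ⟨k, hk⟩
    exact ⟨k, by rw [smul_eq_mul]; linear_combination c * hk⟩

/-- Over a self-injective ring, multiplication by `b` on the `a`-power torsion ideal, with `b`
coprime to `a`, is inverted by multiplication by a ring element. -/
theorem Module.Injective.exists_mul_mul_eq_of_isCoprime {R : Type*} [CommRing R]
    (hR : Module.Injective R R) {a b : R} (hab : IsCoprime a b) :
    ∃ c : R, ∀ x ∈ powTorsionIdeal a, c * b * x = x := by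
  let J := powTorsionIdeal a
  have hinj : Function.Injective (b • J.subtype) := by
    rw [injective_iff_map_eq_zero]
    rintro ⟨x, k, hk⟩ hx
    obtain ⟨u, v, huv⟩ := hab.pow_left (m := k)
    have hbx : b * x = 0 := hx
    exact Subtype.ext (show x = 0 by linear_combination (-x) * huv + u * hk + v * hbx)
  obtain ⟨h, hh⟩ := hR.out (b • J.subtype) hinj J.subtype
  refine ⟨h 1, fun x hx => ?_⟩
  have h₁ : h (b * x) = x := hh ⟨x, hx⟩
  have h₂ : h (b * x) = b * x * h 1 := by
    rw [← smul_eq_mul (b * x) (h 1), ← map_smul, smul_eq_mul, mul_one]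
  linear_combination h₁ - h₂

theorem QmodZ.zsmul_mk_inv_eq_zero_iff {n : ℤ} (hn : n ≠ 0) (m : ℤ) :
    m • (Submodule.Quotient.mk (n : ℚ)⁻¹ : QmodZ) = 0 ↔ n ∣ m := by
  have hn' : (n : ℚ) ≠ 0 := Int.cast_ne_zero.mpr hn
  rw [← Submodule.Quotient.mk_smul, Submodule.Quotient.mk_eq_zero, Submodule.mem_span_singleton]
  refine exists_congr fun t => ?_
  rw [zsmul_eq_mul, zsmul_eq_mul, mul_one, eq_mul_inv_iff_mul_eq₀ hn', mul_comm, eq_comm]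
  exact_mod_cast Iff.rfl

/-- The trivial extension `R = ℤ ⋉ ℚ/ℤ` is not a self-injective ring: `R` is not injective
as a module over itself (indeed, an `R`-module homomorphism `⟨2⟩ ⋉ ℚ/ℤ → R` as in the paper
cannot be extended to `R`). -/
theorem trivSqZeroExt_int_ratCircle_not_self_injective :
    ¬ Module.Injective Rtriv Rtriv := by
  intro hR
  have hcop : IsCoprime (2 : Rtriv) 3 := ⟨-1, 1, by norm_num⟩
  obtain ⟨c, hc⟩ := hR.exists_mul_mul_eq_of_isCoprime hcop
  have hdvd (k : ℕ) : (2 : ℤ) ^ k ∣ 3 * c.fst - 1 := by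
    have hk : (2 : ℤ) ^ k ≠ 0 := by positivity
    let q : QmodZ := Submodule.Quotient.mk (((2 : ℤ) ^ k : ℤ) : ℚ)⁻¹
    have hmul (r : Rtriv) : r * TrivSqZeroExt.inr q = TrivSqZeroExt.inr (r.fst • q) := by
      ext <;> simp
    have hmem : TrivSqZeroExt.inr q ∈ powTorsionIdeal (2 : Rtriv) := by
      refine ⟨k, ?_⟩
      have hfst : ((2 : Rtriv) ^ k).fst = 2 ^ k := by
        rw [TrivSqZeroExt.fst_pow]; rfl
      rw [hmul, hfst, (QmodZ.zsmul_mk_inv_eq_zero_iff hk _).mpr dvd_rfl, TrivSqZeroExt.inr_zero]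
    have hq := hc _ hmem
    have hfst : (c * 3).fst = 3 * c.fst := by
      rw [TrivSqZeroExt.fst_mul, mul_comm]; rfl
    rw [hmul, hfst] at hq
    rw [← QmodZ.zsmul_mk_inv_eq_zero_iff hk, sub_smul, one_smul, sub_eq_zero]
    exact TrivSqZeroExt.inr_injective hq
  have hlt : (3 * c.fst - 1).natAbs < ((2 : ℤ) ^ (3 * c.fst - 1).natAbs).natAbs := by
    rw [Int.natAbs_pow]
    exact Nat.lt_two_pow_self
  have := Int.eq_zero_of_dvd_of_natAbs_lt_natAbs (hdvd _) hlt
  omega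
end
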